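/- Let X be a nonempty finite set, let Q be any Markov transition matrix on X, let μ be a distribution on X, and let δ ∈ (0,1]. Let Q(δ)(x,y) := (1−δ) Q(x,y) + δ μ(y) be the PageRank chain with unique stationary distribution σ_δ. Then for every distribution ν on X and every natural number t, ‖σ_δ − ν Q(δ)^t‖₁ ≤ 2 (1−δ)^t, where ‖ν‖₁ := Σ_x |ν(x)| and ν Q(δ)^t denotes t-fold application of Q(δ) to the row vector ν. -/

import Mathlib

open Finset

/-- The `t`-step evolution of a row vector `ν` under the transition matrix `Q`. -/
noncomputable def evolve {X : Type*} [Fintype X] (Q : X → X → ℝ) (ν : X → ℝ) : ℕ → X → ℝ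
  | 0 => ν
  | t + 1 => fun y => ∑ x, evolve Q ν t x * Q x y

theorem sum_evolve {X : Type*} [Fintype X] {P : X → X → ℝ} (hP : ∀ x, ∑ y, P x y = 1)
    (ν : X → ℝ) (t : ℕ) : ∑ y, evolve P ν t y = ∑ y, ν y := by
  induction t with
  | zero => rfl
  | succ t ih =>
    simp only [evolve]
    rw [Finset.sum_comm]
    simp [← Finset.mul_sum, hP, ih]

/-- A Markov transition matrix is an `ℓ¹` contraction on row vectors. -/
theorem sum_abs_sum_mul_le {X : Type*} [Fintype X] {Q : X → X → ℝ}
    (hQ0 : ∀ x y, 0 ≤ Q x y) (hQ1 : ∀ x, ∑ y, Q x y = 1) (f : X → ℝ) :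
    ∑ y, |∑ x, f x * Q x y| ≤ ∑ x, |f x| :=
  calc ∑ y, |∑ x, f x * Q x y| ≤ ∑ y, ∑ x, |f x| * Q x y := by
        refine Finset.sum_le_sum fun y _ => (Finset.abs_sum_le_sum_abs _ _).trans_eq ?_
        simp only [abs_mul, abs_of_nonneg (hQ0 _ _)]
    _ = ∑ x, |f x| := by
        rw [Finset.sum_comm]
        simp [← Finset.mul_sum, hQ1]

/-- On row vectors of total mass zero the PageRank chain acts as `(1 - δ) Q`. -/
theorem sum_mul_pagerank_of_sum_eq_zero {X : Type*} [Fintype X] (Q : X → X → ℝ) (μ : X → ℝ)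
    (δ : ℝ) {f : X → ℝ} (hf : ∑ x, f x = 0) (y : X) :
    ∑ x, f x * ((1 - δ) * Q x y + δ * μ y) = (1 - δ) * ∑ x, f x * Q x y := by
  simp only [mul_add, Finset.sum_add_distrib, ← Finset.sum_mul, hf, zero_mul, add_zero]
  simp only [Finset.mul_sum, mul_left_comm]

/-- For any Markov chain `Q`, restart distribution `μ` and
`δ ∈ (0,1]`, the stationary distribution `σ_δ` of the PageRank chain
`Q(δ) = (1−δ)Q + δ𝟙ᵀμ` satisfies `‖σ_δ − νQ(δ)^t‖₁ ≤ 2(1−δ)^t` for every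
distribution `ν` and every `t`. -/
theorem pagerank_geometric_mixing {X : Type*} [Fintype X] [Nonempty X]
    (Q : X → X → ℝ) (μ : X → ℝ) (δ : ℝ)
    (hQ0 : ∀ x y, 0 ≤ Q x y) (hQ1 : ∀ x, ∑ y, Q x y = 1)
    (hμ0 : ∀ x, 0 ≤ μ x) (hμ1 : ∑ x, μ x = 1)
    (hδ0 : 0 < δ) (hδ1 : δ ≤ 1)
    (σδ : X → ℝ) (hσδ0 : ∀ x, 0 ≤ σδ x) (hσδ1 : ∑ x, σδ x = 1)
    (hσδstat : ∀ y, ∑ x, σδ x * ((1 - δ) * Q x y + δ * μ y) = σδ y)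
    (ν : X → ℝ) (hν0 : ∀ x, 0 ≤ ν x) (hν1 : ∑ x, ν x = 1)
    (t : ℕ) :
    ∑ y, |σδ y - evolve (fun x y => (1 - δ) * Q x y + δ * μ y) ν t y| ≤
      2 * (1 - δ) ^ t := by
  have hP : ∀ x, ∑ y, ((1 - δ) * Q x y + δ * μ y) = 1 := fun x => by
    rw [Finset.sum_add_distrib, ← Finset.mul_sum, ← Finset.mul_sum, hQ1, hμ1]
    ring
  induction t with
  | zero =>
    calc ∑ y, |σδ y - ν y| ≤ ∑ y, (σδ y + ν y) := by
          refine Finset.sum_le_sum fun y _ => (abs_sub _ _).trans_eq ?_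
          rw [abs_of_nonneg (hσδ0 y), abs_of_nonneg (hν0 y)]
      _ = 2 * (1 - δ) ^ 0 := by
          rw [Finset.sum_add_distrib, hσδ1, hν1]
          norm_num
  | succ t ih =>
    set P : X → X → ℝ := fun x y => (1 - δ) * Q x y + δ * μ y with hPdef
    have hzero : ∑ x, (σδ x - evolve P ν t x) = 0 := by
      rw [Finset.sum_sub_distrib, sum_evolve hP, hσδ1, hν1, sub_self]
    have hstep : ∀ y, σδ y - evolve P ν (t + 1) y =
        (1 - δ) * ∑ x, (σδ x - evolve P ν t x) * Q x y := fun y => by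
      rw [← sum_mul_pagerank_of_sum_eq_zero Q μ δ hzero y]
      simp only [sub_mul (σδ _), Finset.sum_sub_distrib, hσδstat, evolve, hPdef]
    calc ∑ y, |σδ y - evolve P ν (t + 1) y|
        = (1 - δ) * ∑ y, |∑ x, (σδ x - evolve P ν t x) * Q x y| := by
          simp only [hstep, abs_mul, abs_of_nonneg (sub_nonneg.2 hδ1), ← Finset.mul_sum]
      _ ≤ (1 - δ) * (2 * (1 - δ) ^ t) :=
          mul_le_mul_of_nonneg_left ((sum_abs_sum_mul_le hQ0 hQ1 _).trans ih) (sub_nonneg.2 hδ1)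
      _ = 2 * (1 - δ) ^ (t + 1) := by ring
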